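/- arXiv:physics/0409050 — 4 statements merged into one kernel-verified Lean document; each statement's English description precedes it below -/
import Mathlib

section
/- (Proposition B.1: structure of homogeneous solutions for quasi-triangulated networks.) Suppose the network is quasi-triangulated. Then vectors T¹, …, T^N ∈ ℝ² satisfy the homogeneous system (⟨Tⁱ − Tʲ, q^{ij}⟩ = 0 for all i ∼ j, and ⟨Tⁱ, qⁱ⟩ = 0 for all i ∈ I) if and only if there exists t ∈ ℝ such that Tⁱ = t·e₁ for every i = 1, …, N. -/
noncomputable section

/-- Dot product on ℝ² (represented as `Fin 2 → ℝ`). -/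
def dot (v w : Fin 2 → ℝ) : ℝ := v 0 * w 0 + v 1 * w 1

/-- First standard basis vector of ℝ². -/
def e1 : Fin 2 → ℝ := ![1, 0]

/-- Second standard basis vector of ℝ². -/
def e2 : Fin 2 → ℝ := ![0, 1]

/-- A vector of ℝ² orthogonal to two linearly independent vectors is zero. -/
theorem eq_zero_of_dot_eq_zero {a b w : Fin 2 → ℝ} (h : LinearIndependent ℝ ![a, b])
    (ha : dot w a = 0) (hb : dot w b = 0) : w = 0 := by
  unfold dot at ha hb
  rw [LinearIndependent.pair_iff] at h
  have hD : a 0 * b 1 - a 1 * b 0 ≠ 0 := by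
    intro hD
    have h₁ := h (b 1) (-a 1) (by
      ext i
      fin_cases i
      · simp
        linarith
      · simp
        ring)
    have h₀ := h (b 0) (-a 0) (by
      ext i
      fin_cases i
      · simp
        ring
      · simp
        linarith)
    have := h 1 0 (by
      ext i
      fin_cases i
      · simpa using h₀.2
      · simpa using h₁.2)
    exact one_ne_zero this.1
  ext i
  fin_cases i
  · exact (mul_eq_zero.mp (by linear_combination b 1 * ha - a 1 * hb :
      w 0 * (a 0 * b 1 - a 1 * b 0) = 0)).resolve_right hD
  · exact (mul_eq_zero.mp (by linear_combination a 0 * hb - b 0 * ha :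
      w 1 * (a 0 * b 1 - a 1 * b 0) = 0)).resolve_right hD

/-- Proposition B.1: for a quasi-triangulated network, T solves
the homogeneous system iff Tⁱ = t·e₁ for all i, for some common scalar t. -/
theorem stmt9
    (N : ℕ)
    (adj : Fin N → Fin N → Prop)
    (hsymm : ∀ i j, adj i j → adj j i)
    (hirrefl : ∀ i, ¬ adj i i)
    (q : Fin N → Fin N → Fin 2 → ℝ)
    (hq_unit : ∀ i j, adj i j → dot (q i j) (q i j) = 1)
    (hq_anti : ∀ i j, adj i j → q j i = -q i j)
    (Iplus Iminus : Finset (Fin N))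
    (hdisj : Disjoint Iplus Iminus)
    (qb : Fin N → Fin 2 → ℝ)
    (hqb_plus : ∀ i ∈ Iplus, qb i = e2)
    (hqb_minus : ∀ i ∈ Iminus, qb i = -e2)
    -- quasi-triangulation, condition (i): I⁻ nonempty and connected within I⁻
    -- by paths of non-vertical edges
    (hne : Iminus.Nonempty)
    (hconn : ∀ i ∈ Iminus, ∀ j ∈ Iminus, ∃ (m : ℕ) (p : Fin (m + 1) → Fin N),
      p 0 = i ∧ p (Fin.last m) = j ∧ (∀ k, p k ∈ Iminus) ∧
      ∀ k : Fin m, adj (p k.castSucc) (p k.succ) ∧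
        dot (q (p k.castSucc) (p k.succ)) e1 ≠ 0)
    -- quasi-triangulation, condition (ii): an enumeration of the vertices outside
    -- I⁻, each supported by two earlier neighbors with linearly independent edges
    (henum : ∃ (m : ℕ) (v : Fin m → Fin N), Function.Injective v ∧
      (∀ x : Fin N, x ∉ Iminus ↔ ∃ k, v k = x) ∧
      ∀ k : Fin m, ∃ j1 j2 : Fin N,
        adj (v k) j1 ∧ adj (v k) j2 ∧
        (j1 ∈ Iminus ∨ ∃ l, l < k ∧ v l = j1) ∧
        (j2 ∈ Iminus ∨ ∃ l, l < k ∧ v l = j2) ∧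
        LinearIndependent ℝ ![q (v k) j1, q (v k) j2]) :
    ∀ T : Fin N → Fin 2 → ℝ,
      ((∀ i j, adj i j → dot (T i - T j) (q i j) = 0) ∧
        (∀ i ∈ Iplus ∪ Iminus, dot (T i) (qb i) = 0)) ↔
      (∃ t : ℝ, ∀ i, T i = t • e1) := by
  intro T
  constructor
  · rintro ⟨hT, hTb⟩
    have hvert : ∀ i ∈ Iminus, T i 1 = 0 := by
      intro i hi
      have h := hTb i (Finset.mem_union_right _ hi)
      rw [hqb_minus i hi] at h
      simpa [dot, e2] using h
    obtain ⟨i₀, hi₀⟩ := hne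
    have hminus : ∀ j ∈ Iminus, T j = T i₀ 0 • e1 := by
      intro j hj
      obtain ⟨m, p, hp₀, hpm, hp, hstep⟩ := hconn i₀ hi₀ j hj
      have hconst : ∀ k, T (p k) 0 = T i₀ 0 := by
        intro k
        induction k using Fin.induction with
        | zero => rw [hp₀]
        | succ k ih =>
          obtain ⟨hadj, hne⟩ := hstep k
          have h := hT _ _ hadj
          simp only [dot, Pi.sub_apply, hvert _ (hp _), sub_self, zero_mul, add_zero] at h
          have hq : q (p k.castSucc) (p k.succ) 0 ≠ 0 := by simpa [dot, e1] using hne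
          have := (mul_eq_zero.mp h).resolve_right hq
          linarith
      ext i
      fin_cases i
      · simpa [e1, hpm] using hconst (Fin.last m)
      · simpa [e1] using hvert j hj
    refine ⟨T i₀ 0, ?_⟩
    obtain ⟨m, v, -, hv, hsupp⟩ := henum
    have hrest : ∀ k, T (v k) = T i₀ 0 • e1 := by
      intro k
      induction k using WellFoundedLT.induction with
      | ind k ih =>
        obtain ⟨j₁, j₂, hadj₁, hadj₂, hj₁, hj₂, hind⟩ := hsupp k
        have hearlier : ∀ j, (j ∈ Iminus ∨ ∃ l, l < k ∧ v l = j) → T j = T i₀ 0 • e1 := by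
          rintro j (hj | ⟨l, hl, rfl⟩)
          · exact hminus j hj
          · exact ih l hl
        have h₁ := hT _ _ hadj₁
        have h₂ := hT _ _ hadj₂
        rw [hearlier _ hj₁] at h₁
        rw [hearlier _ hj₂] at h₂
        exact sub_eq_zero.mp (eq_zero_of_dot_eq_zero hind h₁ h₂)
    intro i
    by_cases hi : i ∈ Iminus
    · exact hminus i hi
    · obtain ⟨k, rfl⟩ := (hv i).mp hi
      exact hrest k
  · rintro ⟨t, ht⟩
    refine ⟨fun i j _ => by simp [ht, dot], fun i hi => ?_⟩
    rcases Finset.mem_union.mp hi with hi | hi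
    · simp [ht, hqb_plus i hi, dot, e1, e2]
    · simp [ht, hqb_minus i hi, dot, e1, e2]
end
end

section
/- (Proposition 7.3: a vertical spanning path implies percolating rigidity.) Consider a network with vertical-contraction boundary data gⁱ = −e₂ for i ∈ I⁺ and gⁱ = e₂ for i ∈ I⁻. Suppose there exist indices i₁, …, i_m with i₁ ∈ I⁺, i_m ∈ I⁻, i_k ∼ i_{k+1} for 1 ≤ k ≤ m−1, and all edges of this path vertical, i.e. q^{i_k i_{k+1}} = e₂ or q^{i_k i_{k+1}} = −e₂ for each k. Then the system (ns) has no solution, and hence the minimum of the nonnegative quadratic functional Q̂ over (ℝ²)^N is strictly positive. -/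
noncomputable section

/-- If every increment of a chain of real-valued functions has square controlled by `Q`, then
control of the first function (shifted by `a`) propagates along the whole chain. -/
theorem exists_sq_le_mul_along_chain {α : Type*} {m : ℕ} (y : Fin (m + 1) → α → ℝ) (Q : α → ℝ)
    (a : ℝ) (hstart : ∃ C, ∀ T, (y 0 T - a) ^ 2 ≤ C * Q T)
    (hstep : ∀ k : Fin m, ∃ C, ∀ T, (y k.castSucc T - y k.succ T) ^ 2 ≤ C * Q T)
    (k : Fin (m + 1)) : ∃ C, ∀ T, (y k T - a) ^ 2 ≤ C * Q T := by
  induction k using Fin.induction with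
  | zero => exact hstart
  | succ k ih =>
    obtain ⟨C, hC⟩ := ih
    obtain ⟨D, hD⟩ := hstep k
    refine ⟨2 * C + 2 * D, fun T => ?_⟩
    nlinarith [hC T, hD T, sq_nonneg ((y k.castSucc T - a) + (y k.castSucc T - y k.succ T))]

theorem sq_le_mul_of_mul_sq_le {c x Q : ℝ} (hc : 0 < c) (h : c * x ^ 2 ≤ Q) :
    x ^ 2 ≤ c⁻¹ * Q := by
  rw [inv_mul_eq_div, le_div_iff₀ hc]
  linarith

theorem dot_e2 (v : Fin 2 → ℝ) : dot v e2 = v 1 := by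
  simp [dot, e2]

theorem dot_neg_e2 (v : Fin 2 → ℝ) : dot v (-e2) = -v 1 := by
  simp [dot, e2]

/-- Proposition 7.3: for vertical-contraction boundary data, a
network containing a path of vertical edges joining I⁺ to I⁻ has percolating
rigidity: (ns) has no solution and the minimum of Q̂ is strictly positive. -/
theorem stmt13
    (N : ℕ)
    (adj : Fin N → Fin N → Prop) [DecidableRel adj]
    (hsymm : ∀ i j, adj i j → adj j i)
    (hirrefl : ∀ i, ¬ adj i i)
    (q : Fin N → Fin N → Fin 2 → ℝ)
    (hq_unit : ∀ i j, adj i j → dot (q i j) (q i j) = 1)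
    (hq_anti : ∀ i j, adj i j → q j i = -q i j)
    (Iplus Iminus : Finset (Fin N))
    (hdisj : Disjoint Iplus Iminus)
    (qb : Fin N → Fin 2 → ℝ)
    (hqb_plus : ∀ i ∈ Iplus, qb i = e2)
    (hqb_minus : ∀ i ∈ Iminus, qb i = -e2)
    (Csp : Fin N → Fin N → ℝ)
    (hCsp_symm : ∀ i j, Csp i j = Csp j i)
    (hCsp_pos : ∀ i j, adj i j → 0 < Csp i j)
    (Cb : Fin N → ℝ)
    (hCb_pos : ∀ i ∈ Iplus ∪ Iminus, 0 < Cb i)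
    -- vertical-contraction boundary data
    (g : Fin N → Fin 2 → ℝ)
    (hg_plus : ∀ i ∈ Iplus, g i = -e2)
    (hg_minus : ∀ i ∈ Iminus, g i = e2)
    -- a vertical path from I⁺ to I⁻
    (hpath : ∃ (m : ℕ) (p : Fin (m + 1) → Fin N),
      p 0 ∈ Iplus ∧ p (Fin.last m) ∈ Iminus ∧
      ∀ k : Fin m, adj (p k.castSucc) (p k.succ) ∧
        (q (p k.castSucc) (p k.succ) = e2 ∨ q (p k.castSucc) (p k.succ) = -e2))
    (Qhat : (Fin N → Fin 2 → ℝ) → ℝ)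
    (hQhat : ∀ T, Qhat T =
      (1/2) * ∑ i, ∑ j, (if adj i j then Csp i j * (dot (T i - T j) (q i j))^2 else 0)
      + ∑ i ∈ Iplus ∪ Iminus, Cb i * (dot (T i - g i) (qb i))^2) :
    (¬ ∃ T : Fin N → Fin 2 → ℝ,
      (∀ i j, adj i j → dot (T i - T j) (q i j) = 0) ∧
        (∀ i ∈ Iplus ∪ Iminus, dot (T i - g i) (qb i) = 0)) ∧
    0 < ⨅ T : Fin N → Fin 2 → ℝ, Qhat T := by
  have hedge_nonneg : ∀ (T : Fin N → Fin 2 → ℝ) (i j : Fin N),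
      0 ≤ if adj i j then Csp i j * (dot (T i - T j) (q i j)) ^ 2 else 0 := by
    intro T i j
    split_ifs with h
    · exact mul_nonneg (hCsp_pos i j h).le (sq_nonneg _)
    · exact le_rfl
  have hbdry_nonneg : ∀ (T : Fin N → Fin 2 → ℝ), ∀ i ∈ Iplus ∪ Iminus,
      0 ≤ Cb i * (dot (T i - g i) (qb i)) ^ 2 :=
    fun T i hi => mul_nonneg (hCb_pos i hi).le (sq_nonneg _)
  have hedges_nonneg : ∀ T : Fin N → Fin 2 → ℝ, 0 ≤ ∑ i, ∑ j,
      (if adj i j then Csp i j * (dot (T i - T j) (q i j)) ^ 2 else 0) :=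
    fun T => Finset.sum_nonneg fun i _ => Finset.sum_nonneg fun j _ => hedge_nonneg T i j
  have hQ_nonneg : ∀ T, 0 ≤ Qhat T := by
    intro T
    rw [hQhat]
    have := hedges_nonneg T
    have := Finset.sum_nonneg (hbdry_nonneg T)
    positivity
  have hedge_le : ∀ i j, adj i j → ∀ T : Fin N → Fin 2 → ℝ,
      (dot (T i - T j) (q i j)) ^ 2 ≤ (Csp i j / 2)⁻¹ * Qhat T := by
    intro i j hij T
    refine sq_le_mul_of_mul_sq_le (half_pos (hCsp_pos i j hij)) ?_
    have hj := Finset.single_le_sum (fun j _ => hedge_nonneg T i j) (Finset.mem_univ j)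
    have hi := Finset.single_le_sum
      (fun i _ => Finset.sum_nonneg fun j (_ : j ∈ Finset.univ) => hedge_nonneg T i j)
      (Finset.mem_univ i)
    rw [if_pos hij] at hj
    rw [hQhat]
    linarith [Finset.sum_nonneg (hbdry_nonneg T)]
  have hbdry_le : ∀ i ∈ Iplus ∪ Iminus, ∀ T : Fin N → Fin 2 → ℝ,
      (dot (T i - g i) (qb i)) ^ 2 ≤ (Cb i)⁻¹ * Qhat T := by
    intro i hi T
    refine sq_le_mul_of_mul_sq_le (hCb_pos i hi) ?_
    have := Finset.single_le_sum (hbdry_nonneg T) hi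
    rw [hQhat]
    linarith [hedges_nonneg T]
  obtain ⟨K, hK⟩ : ∃ K, ∀ T, 4 ≤ K * Qhat T := by
    obtain ⟨m, p, hp0, hpm, hp⟩ := hpath
    obtain ⟨C, hC⟩ := exists_sq_le_mul_along_chain
      (fun k (T : Fin N → Fin 2 → ℝ) => T (p k) 1) Qhat (-1)
      ⟨_, fun T => by
        have h := hbdry_le _ (Finset.mem_union_left _ hp0) T
        rw [hqb_plus _ hp0, hg_plus _ hp0, dot_e2] at h
        simpa [e2] using h⟩
      (fun k => ⟨_, fun T => by
        have h := hedge_le _ _ (hp k).1 T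
        rcases (hp k).2 with hq | hq
        · rw [hq, dot_e2] at h
          exact h
        · rw [hq, dot_neg_e2, neg_sq] at h
          exact h⟩)
      (Fin.last m)
    refine ⟨2 * C + 2 * (Cb (p (Fin.last m)))⁻¹, fun T => ?_⟩
    have h := hbdry_le _ (Finset.mem_union_right _ hpm) T
    rw [hqb_minus _ hpm, hg_minus _ hpm, dot_neg_e2, neg_sq] at h
    have h' : (T (p (Fin.last m)) 1 - 1) ^ 2 ≤ (Cb (p (Fin.last m)))⁻¹ * Qhat T := by
      simpa [e2] using h
    nlinarith [hC T, sq_nonneg (T (p (Fin.last m)) 1)]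
  constructor
  · rintro ⟨T, hT, hTb⟩
    have hzero : Qhat T = 0 := by
      rw [hQhat, Finset.sum_eq_zero, Finset.sum_eq_zero]
      · norm_num
      · intro i hi
        simp [hTb i hi]
      · intro i _
        refine Finset.sum_eq_zero fun j _ => ?_
        split_ifs with h
        · simp [hT i j h]
        · rfl
    have := hK T
    rw [hzero] at this
    linarith
  · have hKpos : 0 < K := by
      by_contra hneg
      nlinarith [hK 0, hQ_nonneg 0]
    refine lt_of_lt_of_le (div_pos four_pos hKpos) (le_ciInf fun T => ?_)
    rw [div_le_iff₀ hKpos]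
    linarith [hK T]
end
end

section
/- (Rotated rectangular lattice yields weak blow up.) Let k = (k₁, k₂) ∈ ℝ² be a unit vector with k₁ = ⟨k, e₁⟩ ≠ 0, and let k^⊥ = (−k₂, k₁). Fix integers R ≥ 2 and M ≥ 1 and consider unknown vectors T^{r,c} ∈ ℝ² for 1 ≤ r ≤ R, 1 ≤ c ≤ M, subject to the system: ⟨T^{1,c} − e₂, e₂⟩ = 0 and ⟨T^{R,c} + e₂, e₂⟩ = 0 for every c; ⟨T^{r,c} − T^{r+1,c}, k⟩ = 0 for all 1 ≤ r ≤ R−1 and all c; and ⟨T^{r,c} − T^{r,c+1}, k^⊥⟩ = 0 for all r and all 1 ≤ c ≤ M−1. Then this system has infinitely many solutions. In particular, the minimum of any truncated dissipation functional whose constraints are exactly these equations is 0 (weak blow up of the extensional effective viscosity for the rotated rectangular lattice). -/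
noncomputable section

/-- rotated rectangular lattice yields weak blow up: for a unit
vector k = (k₁,k₂) with k₁ ≠ 0, k⊥ = (−k₂,k₁), and a rotated rectangular
lattice with R = r+2 ≥ 2 rows and M = m+1 ≥ 1 columns, the system of spring
constraints has infinitely many solutions. -/
theorem stmt15
    (k : Fin 2 → ℝ)
    (hk_unit : dot k k = 1)
    (hk1 : dot k e1 ≠ 0)
    (kperp : Fin 2 → ℝ)
    (hkperp : kperp = ![-(k 1), k 0])
    (r m : ℕ) :
    {T : Fin (r + 2) → Fin (m + 1) → Fin 2 → ℝ |
      (∀ c, dot (T 0 c - e2) e2 = 0) ∧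
      (∀ c, dot (T (Fin.last (r + 1)) c + e2) e2 = 0) ∧
      (∀ (i : Fin (r + 1)) (c : Fin (m + 1)),
        dot (T i.castSucc c - T i.succ c) k = 0) ∧
      (∀ (i : Fin (r + 2)) (c : Fin m),
        dot (T i c.castSucc - T i c.succ) kperp = 0)}.Infinite := by
  have hk0 : k 0 ≠ 0 := by simpa [dot, e1] using hk1
  -- Every solution below has constant `k`-component `t` and second coordinate `±1`.
  let s : Fin (r + 2) → ℝ := fun i => if i = 0 then 1 else -1
  let T : ℝ → Fin (r + 2) → Fin (m + 1) → Fin 2 → ℝ :=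
    fun t i _ => ![(t - s i * k 1) / k 0, s i]
  have hT : ∀ t i c, dot (T t i c) k = t := by
    intro t i c
    simp only [dot, T, Matrix.cons_val_zero, Matrix.cons_val_one]
    field_simp
    ring
  refine Set.infinite_of_injective_forall_mem (f := T) ?_ ?_
  · intro t u htu
    rw [← hT t 0 0, htu, hT u 0 0]
  · intro t
    refine ⟨fun c => ?_, fun c => ?_, fun i c => ?_, fun i c => ?_⟩
    · simp [dot, e2, T, s]
    · simp [dot, e2, T, s, Fin.last_eq_zero_iff]
    · have hi := hT t i.castSucc c
      have hj := hT t i.succ c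
      simp only [dot, Pi.sub_apply] at hi hj ⊢
      linear_combination hi - hj
    · simp [dot, T]
end
end

section
/- (A path with a non-vertical edge has no percolating rigidity.) Let N ≥ 2 and let q₁, …, q_{N−1} ∈ ℝ² be unit vectors such that ⟨q_j, e₁⟩ ≠ 0 for at least one index j. Then there exist vectors T¹, …, T^N ∈ ℝ² satisfying ⟨T¹ − e₂, e₂⟩ = 0, ⟨Tⁱ − Tⁱ⁺¹, qᵢ⟩ = 0 for all 1 ≤ i ≤ N−1, and ⟨T^N + e₂, e₂⟩ = 0. -/
noncomputable section

/-- a path with a non-vertical edge has no percolating rigidity: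
for N ≥ 2 (here N = n+2) and unit edge directions q₁,…,q_{N−1} at least one of
which is non-vertical, the path system has a solution. -/
theorem stmt16
    (n : ℕ)
    (q : Fin (n + 1) → Fin 2 → ℝ)
    (hq_unit : ∀ i, dot (q i) (q i) = 1)
    (hq_nonvert : ∃ j, dot (q j) e1 ≠ 0) :
    ∃ T : Fin (n + 2) → Fin 2 → ℝ,
      dot (T 0 - e2) e2 = 0 ∧
      (∀ i : Fin (n + 1), dot (T i.castSucc - T i.succ) (q i) = 0) ∧
      dot (T (Fin.last (n + 1)) + e2) e2 = 0 := by
  obtain ⟨j, hj⟩ := hq_nonvert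
  have hj0 : q j 0 ≠ 0 := by simpa [dot, e1] using hj
  refine ⟨fun i => if i ≤ j.castSucc then e2 else ![2 * q j 1 / q j 0, -1], ?_, ?_, ?_⟩
  · simp [dot]
  · intro i
    rcases lt_trichotomy i j with h | rfl | h
    · have h1 : i.castSucc ≤ j.castSucc := by simpa using h.le
      have h2 : i.succ ≤ j.castSucc := by simpa [Fin.succ_le_castSucc_iff] using h
      simp [dot, h1, h2]
    · have h2 : ¬ i.succ ≤ i.castSucc := by simp
      simp only [dot, le_refl, if_true, h2, if_false, e2, Pi.sub_apply, Matrix.cons_val_zero,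
        Matrix.cons_val_one]
      field_simp
      ring
    · have h1 : ¬ i.castSucc ≤ j.castSucc := by simpa using h
      have h2 : ¬ i.succ ≤ j.castSucc := by simpa [Fin.succ_le_castSucc_iff] using h.le
      simp [dot, h1, h2]
  · have h : ¬ Fin.last (n + 1) ≤ j.castSucc := not_le.mpr (Fin.castSucc_lt_last j)
    simp [dot, h, e2]
end
end
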